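/- arXiv:math/9808033 — 3 statements merged into one kernel-verified Lean document; each statement's English description precedes it below -/
import Mathlib

section
/- Let H be a real Hilbert space and let T : H → H be a surjective function (linearity not assumed) with the property that |⟨Tx, Ty⟩| = |⟨x, y⟩| for all x, y ∈ H. Then there exist a unitary (orthogonal) operator U : H → H and a function φ : H → {-1, 1} such that Tx = φ(x)·Ux for every x ∈ H. -/
open scoped RealInnerProductSpace

section InnerPreserving

variable {H : Type*} [NormedAddCommGroup H] [InnerProductSpace ℝ H]

/-- A map preserving the inner product is additive. -/
lemma map_add_of_inner_eq {U : H → H} (hU : ∀ x y, ⟪U x, U y⟫ = ⟪x, y⟫) (a b : H) :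
    U (a + b) = U a + U b := by
  rw [← sub_eq_zero, ← inner_self_eq_zero (𝕜 := ℝ)]
  simp only [inner_sub_left, inner_sub_right, inner_add_left, inner_add_right, hU]
  ring

/-- A map preserving the inner product is homogeneous. -/
lemma map_smul_of_inner_eq {U : H → H} (hU : ∀ x y, ⟪U x, U y⟫ = ⟪x, y⟫) (c : ℝ) (a : H) :
    U (c • a) = c • U a := by
  rw [← sub_eq_zero, ← inner_self_eq_zero (𝕜 := ℝ)]
  simp only [inner_sub_left, inner_sub_right, real_inner_smul_left, real_inner_smul_right, hU]
  ring

/-- Two vectors close to a common unit vector have positive inner product. -/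
lemma inner_pos_of_norm_sub_le {e p q : H} (he : ‖e‖ = 1) (hp : ‖p - e‖ ≤ 1 / 4)
    (hq : ‖q - e‖ ≤ 1 / 4) : 0 < ⟪p, q⟫ := by
  have h1 := neg_le_of_abs_le (abs_real_inner_le_norm e (q - e))
  have h2 := neg_le_of_abs_le (abs_real_inner_le_norm (p - e) e)
  have h3 := neg_le_of_abs_le (abs_real_inner_le_norm (p - e) (q - e))
  have h4 : ‖p - e‖ * ‖q - e‖ ≤ 1 / 4 * (1 / 4) :=
    mul_le_mul hp hq (norm_nonneg _) (by norm_num)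
  have h5 : ⟪p, q⟫ = ⟪e, e⟫ + ⟪e, q - e⟫ + ⟪p - e, e⟫ + ⟪p - e, q - e⟫ := by
    simp only [inner_sub_left, inner_sub_right]
    ring
  rw [real_inner_self_eq_norm_sq] at h5
  rw [he] at h1 h2 h5
  linarith

/-- A map preserving absolute values of inner products agrees up to signs, near a given unit
vector, with a map preserving inner products. -/
lemma exists_inner_eq_near {T : H → H} (hT : ∀ x y : H, |⟪T x, T y⟫| = |⟪x, y⟫|)
    {e : H} (he : ‖e‖ = 1) :
    ∃ S : H → H, (∀ x, S x = T x ∨ S x = -T x) ∧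
      ∀ x y, ‖x - e‖ ≤ 1 / 4 → ‖y - e‖ ≤ 1 / 4 → ⟪S x, S y⟫ = ⟪x, y⟫ := by
  have hnorm : ∀ x, ⟪T x, T x⟫ = ⟪x, x⟫ := fun x => by
    simpa only [abs_of_nonneg real_inner_self_nonneg] using hT x x
  have hTe : ‖T e‖ = 1 := by
    have h := hnorm e
    rw [real_inner_self_eq_norm_sq, real_inner_self_eq_norm_sq, he] at h
    exact (pow_left_inj₀ (norm_nonneg _) zero_le_one two_ne_zero).1 h
  set S : H → H := fun x => if 0 ≤ ⟪T x, T e⟫ then T x else -T x with hS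
  have hsign : ∀ x, S x = T x ∨ S x = -T x := fun x => by
    by_cases h : 0 ≤ ⟪T x, T e⟫ <;> simp [hS, h]
  have hSe : ∀ x, ⟪S x, T e⟫ = |⟪x, e⟫| := fun x => by
    rw [← hT]
    by_cases h : 0 ≤ ⟪T x, T e⟫
    · simp [hS, h, abs_of_nonneg h]
    · simp [hS, h, abs_of_neg (not_le.1 h)]
  have hSS : ∀ x, ⟪S x, S x⟫ = ⟪x, x⟫ := fun x => by
    rcases hsign x with h | h <;> simp only [h, inner_neg_neg, hnorm]
  have hnear : ∀ x, ‖x - e‖ ≤ 1 / 4 → ‖S x - T e‖ ≤ 1 / 4 := fun x hx => by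
    have hpos : 0 < ⟪x, e⟫ := inner_pos_of_norm_sub_le he hx (by simp)
    have h : ⟪S x - T e, S x - T e⟫ = ⟪x - e, x - e⟫ := by
      rw [real_inner_sub_sub_self, real_inner_sub_sub_self, hSS, hSe, hnorm, abs_of_pos hpos]
    rw [real_inner_self_eq_norm_sq, real_inner_self_eq_norm_sq] at h
    rwa [(pow_left_inj₀ (norm_nonneg _) (norm_nonneg _) two_ne_zero).1 h]
  refine ⟨S, hsign, fun x y hx hy => ?_⟩
  have h1 : 0 < ⟪x, y⟫ := inner_pos_of_norm_sub_le he hx hy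
  have h2 : 0 < ⟪S x, S y⟫ := inner_pos_of_norm_sub_le hTe (hnear x hx) (hnear y hy)
  have h3 : |⟪S x, S y⟫| = |⟪x, y⟫| := by
    rw [← hT x y]
    rcases hsign x with h | h <;> rcases hsign y with h' | h' <;> simp [h, h']
  rwa [abs_of_pos h1, abs_of_pos h2] at h3

/-- A map preserving absolute values of inner products agrees up to signs with a map preserving
inner products. -/
lemma exists_inner_eq_and_eq_or_eq_neg {T : H → H}
    (hT : ∀ x y : H, |⟪T x, T y⟫| = |⟪x, y⟫|) :
    ∃ U : H → H, (∀ x y, ⟪U x, U y⟫ = ⟪x, y⟫) ∧ ∀ x, T x = U x ∨ T x = -U x := by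
  rcases subsingleton_or_nontrivial H with _ | _
  · exact ⟨id, fun _ _ => rfl, fun _ => Or.inl (Subsingleton.elim _ _)⟩
  obtain ⟨e, he⟩ := exists_norm_eq H zero_le_one
  obtain ⟨S, hsign, hS⟩ := exists_inner_eq_near hT he
  set c : H → ℝ := fun a => 1 / (4 * (1 + ‖a‖)) with hc
  have hcpos : ∀ a, 0 < c a := fun a => by positivity
  have hcneg : ∀ a, c (-a) = c a := fun a => by simp [hc]
  have hball : ∀ a, ‖e + c a • a - e‖ ≤ 1 / 4 := fun a => by
    rw [add_sub_cancel_left, norm_smul, Real.norm_of_nonneg (hcpos a).le, hc]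
    have := norm_nonneg a
    rw [div_mul_eq_mul_div, div_le_div_iff₀ (by positivity) (by norm_num)]
    linarith
  have hball₀ : ‖e - e‖ ≤ 1 / 4 := by simp
  set U : H → H := fun a => (c a)⁻¹ • (S (e + c a • a) - S e) with hUdef
  have hSU : ∀ a, S (e + c a • a) = S e + c a • U a := fun a => by
    simp only [hUdef]
    rw [smul_inv_smul₀ (hcpos a).ne', add_sub_cancel]
  have hU : ∀ x y, ⟪U x, U y⟫ = ⟪x, y⟫ := fun x y => by
    have hx := (hcpos x).ne'
    have hy := (hcpos y).ne'
    simp only [hUdef, real_inner_smul_left, real_inner_smul_right, inner_sub_left, inner_sub_right]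
    rw [hS _ _ (hball x) (hball y), hS _ _ (hball x) hball₀, hS _ _ hball₀ (hball y),
      hS _ _ hball₀ hball₀]
    simp only [inner_add_left, inner_add_right, real_inner_smul_left, real_inner_smul_right]
    field_simp
    ring
  refine ⟨U, hU, fun x => ?_⟩
  have hsq : ∀ z, ⟪T x, S z⟫ ^ 2 = ⟪x, z⟫ ^ 2 := fun z => by
    rw [sq_eq_sq_iff_abs_eq_abs, ← hT x z]
    rcases hsign z with h | h <;> simp [h]
  have hUneg : U (-x) = -U x := by
    simpa using map_smul_of_inner_eq hU (-1) x
  have h0 := hsq e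
  have h1 := hsq (e + c x • x)
  have h2 := hsq (e + c (-x) • -x)
  rw [hSU] at h1 h2
  rw [hUneg, hcneg] at h2
  simp only [inner_add_right, real_inner_smul_right, inner_neg_right] at h1 h2
  have h3 : ⟪T x, U x⟫ ^ 2 = ⟪x, x⟫ ^ 2 := by
    have hx : c x ^ 2 ≠ 0 := pow_ne_zero 2 (hcpos x).ne'
    apply mul_left_cancel₀ hx
    linear_combination (h1 + h2) / 2 - h0
  have hnorm : ⟪T x, T x⟫ = ⟪x, x⟫ := by
    simpa only [abs_of_nonneg real_inner_self_nonneg] using hT x x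
  rcases sq_eq_sq_iff_eq_or_eq_neg.1 h3 with h | h
  · left
    rw [← sub_eq_zero, ← inner_self_eq_zero (𝕜 := ℝ), real_inner_sub_sub_self, hnorm, hU, h]
    ring
  · right
    rw [eq_neg_iff_add_eq_zero, ← inner_self_eq_zero (𝕜 := ℝ), real_inner_add_add_self, hnorm,
      hU, h]
    ring

end InnerPreserving

/-- **The real version of Wigner's theorem.**  If `T` is a surjective map on a real
Hilbert space with `|⟨Tx,Ty⟩| = |⟨x,y⟩|` for all `x, y`, then `T x = φ(x) • U x` where
`U` is a unitary (orthogonal) operator and `φ` takes values in `{-1, 1}`. -/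
theorem wigner_real {H : Type*} [NormedAddCommGroup H]
    [InnerProductSpace ℝ H] [CompleteSpace H]
    (T : H → H) (hT_surj : Function.Surjective T)
    (hT : ∀ x y : H, |⟪T x, T y⟫| = |⟪x, y⟫|) :
    ∃ (U : H →ₗ[ℝ] H) (φ : H → ℝ),
      Function.Bijective U ∧
      (∀ x y : H, ⟪U x, U y⟫ = ⟪x, y⟫) ∧
      (∀ x, φ x = 1 ∨ φ x = -1) ∧
      (∀ x, T x = φ x • U x) := by
  classical
  obtain ⟨U, hU, hTU⟩ := exists_inner_eq_and_eq_or_eq_neg hT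
  let L : H →ₗ[ℝ] H :=
    { toFun := U
      map_add' := map_add_of_inner_eq hU
      map_smul' := map_smul_of_inner_eq hU }
  refine ⟨L, fun x => if T x = U x then 1 else -1, ⟨?_, fun y => ?_⟩, hU, fun x => ?_,
    fun x => ?_⟩
  · rw [← LinearMap.ker_eq_bot, LinearMap.ker_eq_bot']
    intro x (hx : U x = 0)
    rw [← inner_self_eq_zero (𝕜 := ℝ), ← hU, hx, inner_zero_left]
  · obtain ⟨x, rfl⟩ := hT_surj y
    rcases hTU x with h | h
    · exact ⟨x, h.symm⟩
    · exact ⟨-x, by rw [map_neg, h]; rfl⟩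
  · by_cases h : T x = U x <;> simp [h]
  · change T x = _ • U x
    by_cases h : T x = U x
    · simp [h]
    · simpa [h] using (hTU x).resolve_left h
end

section
/- Let 𝒜 be a unital C*-algebra and let φ : 𝒜 → 𝒜 be a surjective function such that |φ(A)φ(B)*| = |AB*| for all A, B ∈ 𝒜. Then φ(I) is a unitary element of 𝒜. -/
/-- The absolute value `|a|` of an element `a` of a C*-algebra: the unique positive
square root of `a* a`. -/
noncomputable def cstarAbs {𝒜 : Type*} [CStarAlgebra 𝒜] [PartialOrder 𝒜]
    [StarOrderedRing 𝒜] (a : 𝒜) : 𝒜 :=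
  CFC.sqrt (star a * a)

theorem cstarAbs_mul_self {𝒜 : Type*} [CStarAlgebra 𝒜] [PartialOrder 𝒜]
    [StarOrderedRing 𝒜] (a : 𝒜) : cstarAbs a * cstarAbs a = star a * a :=
  CFC.sqrt_mul_sqrt_self _ (star_mul_self_nonneg a)

theorem cstarAbs_mul_star {𝒜 : Type*} [CStarAlgebra 𝒜] [PartialOrder 𝒜]
    [StarOrderedRing 𝒜] (a : 𝒜) : cstarAbs (a * star a) = a * star a := by
  rw [cstarAbs, star_mul, star_star]
  exact CFC.sqrt_mul_self _ (mul_star_self_nonneg a)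

/-- If `𝒜` is a unital C*-algebra and `φ : 𝒜 → 𝒜` is a surjective map satisfying
`|φ(A)φ(B)*| = |AB*|` for all `A, B ∈ 𝒜`, then `φ(1)` is a unitary element. -/
theorem phi_one_unitary {𝒜 : Type*} [CStarAlgebra 𝒜] [PartialOrder 𝒜]
    [StarOrderedRing 𝒜]
    (φ : 𝒜 → 𝒜) (hφ_surj : Function.Surjective φ)
    (hφ : ∀ A B : 𝒜, cstarAbs (φ A * star (φ B)) = cstarAbs (A * star B)) :
    star (φ 1) * φ 1 = 1 ∧ φ 1 * star (φ 1) = 1 := by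
  have h_self (A : 𝒜) : φ A * star (φ A) = A * star A := by
    simpa only [cstarAbs_mul_star] using hφ A A
  refine ⟨?_, by simpa using h_self 1⟩
  obtain ⟨B, hB⟩ := hφ_surj 1
  have hBB : B * star B = 1 := by simpa [hB] using (h_self B).symm
  have h := cstarAbs_mul_self (φ 1 * star (φ B))
  rw [hφ, cstarAbs_mul_self] at h
  simpa [hB, hBB] using h.symm
end

section
/- Let 𝒜 be a unital C*-algebra and let φ : 𝒜 → 𝒜 be a surjective function such that |φ(A)φ(B)*| = |AB*| for all A, B ∈ 𝒜. If A, B, A', B' ∈ 𝒜 satisfy A*A − B*B = A'*A' − B'*B', then φ(A)*φ(A) − φ(B)*φ(B) = φ(A')*φ(A') − φ(B')*φ(B'). Hence the map ψ given by ψ(A*A − B*B) = φ(A)*φ(A) − φ(B)*φ(B) is a well-defined map on the self-adjoint elements of 𝒜. -/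
/-- If `𝒜` is a unital C*-algebra and `φ : 𝒜 → 𝒜` is a surjective map satisfying
`|φ(A)φ(B)*| = |AB*|`, and `A*A − B*B = A'*A' − B'*B'`, then
`φ(A)*φ(A) − φ(B)*φ(B) = φ(A')*φ(A') − φ(B')*φ(B')`; hence the map
`ψ(A*A − B*B) = φ(A)*φ(A) − φ(B)*φ(B)` is well defined on self-adjoint elements. -/
theorem psi_well_defined {𝒜 : Type*} [CStarAlgebra 𝒜] [PartialOrder 𝒜]
    [StarOrderedRing 𝒜]
    (φ : 𝒜 → 𝒜) (hφ_surj : Function.Surjective φ)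
    (hφ : ∀ A B : 𝒜, cstarAbs (φ A * star (φ B)) = cstarAbs (A * star B))
    (A B A' B' : 𝒜) (h : star A * A - star B * B = star A' * A' - star B' * B') :
    star (φ A) * φ A - star (φ B) * φ B = star (φ A') * φ A' - star (φ B') * φ B' := by
  have conj_eq (X C : 𝒜) :
      φ C * (star (φ X) * φ X) * star (φ C) = C * (star X * X) * star C := by
    have h₁ := cstarAbs_mul_self (φ X * star (φ C))
    rw [hφ, cstarAbs_mul_self] at h₁
    simpa only [star_mul, star_star, mul_assoc] using h₁.symm
  obtain ⟨C, hC⟩ := hφ_surj 1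
  have eq_conj (X : 𝒜) : star (φ X) * φ X = C * (star X * X) * star C := by
    simpa [hC] using conj_eq X C
  simp only [eq_conj, ← sub_mul, ← mul_sub, h]
end
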